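/- arXiv:2310.06478 — 3 statements merged into one kernel-verified Lean document; each statement's English description precedes it below -/
import Mathlib

section
/- Let Ω ⊂ ℝⁿ (n ≥ 2) be a bounded domain with Lipschitz boundary and let γ, β, θ, ξ, α, θ₁ ∈ M₀(Ω) satisfy: θ₁(x) ≤ θ(x), β(x) ≥ α(x) and ξ(x)β(x) = γ(x)α(x) for a.e. x ∈ Ω. Then for every u ∈ C¹(Ω), Re^{ξ,α,θ₁}(u) ≤ Re^{γ,β,θ}(u) + (n+1)|Ω|; in particular, Re^{γ,β,θ}(u) < ∞ implies Re^{ξ,α,θ₁}(u) < ∞, so the embedding S_{1,γ(x),β(x),θ(x)}(Ω) ⊂ S_{1,ξ(x),α(x),θ₁(x)}(Ω) holds. -/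
open MeasureTheory Real Set
open scoped ENNReal

/-- The functional `Re^{γ,β,θ}(u) = ∫_Ω |u|^{θ(x)} dx + ∑_i ∫_Ω |u|^{γ(x)} |D_i u|^{β(x)} dx`
(with values in `ℝ≥0∞`, so that finiteness is expressible); the variable-exponent
pn-space `S_{1,γ(x),β(x),θ(x)}(Ω)` consists of the `u ∈ L¹(Ω)` with `Re^{γ,β,θ}(u) < ∞`. -/
noncomputable def ReFun (n : ℕ) (Ω : Set (Fin n → ℝ))
    (γ β θ : (Fin n → ℝ) → ℝ) (u : (Fin n → ℝ) → ℝ) : ℝ≥0∞ :=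
  (∫⁻ x in Ω, ENNReal.ofReal (|u x| ^ θ x)) +
    ∑ i : Fin n, ∫⁻ x in Ω,
      ENNReal.ofReal (|u x| ^ γ x * |fderiv ℝ u x (Pi.single i 1)| ^ β x)

theorem rpow_le_rpow_add_one {t a b : ℝ} (ht : 0 ≤ t) (ha : 0 ≤ a) (hab : a ≤ b) :
    t ^ a ≤ t ^ b + 1 := by
  rcases le_total t 1 with h | h
  · linarith [Real.rpow_le_one ht h ha, Real.rpow_nonneg ht b]
  · linarith [Real.rpow_le_rpow_of_exponent_le h hab]

theorem rpow_mul_rpow_le_add_one {s t a b c d : ℝ} (hs : 0 ≤ s) (ht : 0 ≤ t)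
    (hb : 0 ≤ b) (hd : 0 < d) (hbd : b ≤ d) (h : a * d = c * b) :
    s ^ a * t ^ b ≤ s ^ c * t ^ d + 1 := by
  have ha : a = c * (b / d) := by field_simp; exact h
  have hb' : b = d * (b / d) := by field_simp
  have hst : s ^ a * t ^ b = (s ^ c * t ^ d) ^ (b / d) := by
    rw [Real.mul_rpow (Real.rpow_nonneg hs c) (Real.rpow_nonneg ht d), ← Real.rpow_mul hs,
      ← Real.rpow_mul ht, ← ha, ← hb']
  rw [hst]
  simpa using rpow_le_rpow_add_one (by positivity : 0 ≤ s ^ c * t ^ d)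
    (div_nonneg hb hd.le) ((div_le_one hd).2 hbd)

theorem lintegral_ofReal_le_add_measure {X : Type*} [MeasurableSpace X] {μ : Measure X}
    {f g : X → ℝ} (h : ∀ᵐ x ∂μ, f x ≤ g x + 1) :
    ∫⁻ x, ENNReal.ofReal (f x) ∂μ ≤ (∫⁻ x, ENNReal.ofReal (g x) ∂μ) + μ univ := by
  calc ∫⁻ x, ENNReal.ofReal (f x) ∂μ ≤ ∫⁻ x, (ENNReal.ofReal (g x) + 1) ∂μ := by
        refine lintegral_mono_ae ?_
        filter_upwards [h] with x hx
        refine (ENNReal.ofReal_le_ofReal hx).trans (ENNReal.ofReal_add_le.trans ?_)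
        rw [ENNReal.ofReal_one]
    _ = (∫⁻ x, ENNReal.ofReal (g x) ∂μ) + μ univ := by
        rw [lintegral_add_right _ measurable_const, lintegral_one]

/-- Lemma 4.4, case (i): Let `Ω ⊂ ℝⁿ` (`n ≥ 2`) be a bounded
domain with (Lipschitz) boundary and `γ, β, θ, ξ, α, θ₁ ∈ M₀(Ω)` with
`θ₁ ≤ θ`, `β ≥ α` and `ξβ = γα` a.e.  Then for every `u ∈ C¹(Ω)`,
`Re^{ξ,α,θ₁}(u) ≤ Re^{γ,β,θ}(u) + (n+1)|Ω|`; in particular finiteness of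
`Re^{γ,β,θ}(u)` implies finiteness of `Re^{ξ,α,θ₁}(u)`, i.e.
`S_{1,γ(x),β(x),θ(x)}(Ω) ⊂ S_{1,ξ(x),α(x),θ₁(x)}(Ω)`. -/
theorem stmt_16 (n : ℕ) (hn : 2 ≤ n) (Ω : Set (Fin n → ℝ))
    (hΩ_open : IsOpen Ω) (hΩ_bdd : Bornology.IsBounded Ω) (hΩ_conn : IsConnected Ω)
    (γ β θ ξ α θ₁ : (Fin n → ℝ) → ℝ)
    (hγm : Measurable γ) (hβm : Measurable β) (hθm : Measurable θ)
    (hξm : Measurable ξ) (hαm : Measurable α) (hθ₁m : Measurable θ₁)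
    (hγ1 : ∀ᵐ x ∂(volume.restrict Ω), 1 ≤ γ x)
    (hβ1 : ∀ᵐ x ∂(volume.restrict Ω), 1 ≤ β x)
    (hθ1 : ∀ᵐ x ∂(volume.restrict Ω), 1 ≤ θ x)
    (hξ1 : ∀ᵐ x ∂(volume.restrict Ω), 1 ≤ ξ x)
    (hα1 : ∀ᵐ x ∂(volume.restrict Ω), 1 ≤ α x)
    (hθ₁1 : ∀ᵐ x ∂(volume.restrict Ω), 1 ≤ θ₁ x)
    (hγb : ∃ M : ℝ, ∀ᵐ x ∂(volume.restrict Ω), γ x ≤ M)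
    (hβb : ∃ M : ℝ, ∀ᵐ x ∂(volume.restrict Ω), β x ≤ M)
    (hθb : ∃ M : ℝ, ∀ᵐ x ∂(volume.restrict Ω), θ x ≤ M)
    (hξb : ∃ M : ℝ, ∀ᵐ x ∂(volume.restrict Ω), ξ x ≤ M)
    (hαb : ∃ M : ℝ, ∀ᵐ x ∂(volume.restrict Ω), α x ≤ M)
    (hθ₁b : ∃ M : ℝ, ∀ᵐ x ∂(volume.restrict Ω), θ₁ x ≤ M)
    (hθθ₁ : ∀ᵐ x ∂(volume.restrict Ω), θ₁ x ≤ θ x)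
    (hβα : ∀ᵐ x ∂(volume.restrict Ω), α x ≤ β x)
    (hξβγα : ∀ᵐ x ∂(volume.restrict Ω), ξ x * β x = γ x * α x)
    (u : (Fin n → ℝ) → ℝ) (hu : ContDiffOn ℝ 1 u Ω) :
    ReFun n Ω ξ α θ₁ u ≤ ReFun n Ω γ β θ u + ((n : ℝ≥0∞) + 1) * volume Ω := by
  have h₀ := lintegral_ofReal_le_add_measure (μ := volume.restrict Ω)
    (f := fun x => |u x| ^ θ₁ x) (g := fun x => |u x| ^ θ x) (by
      filter_upwards [hθ₁1, hθθ₁] with x h1 h2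
      exact rpow_le_rpow_add_one (abs_nonneg _) (by linarith) h2)
  have h₁ (i : Fin n) := lintegral_ofReal_le_add_measure (μ := volume.restrict Ω)
    (f := fun x => |u x| ^ ξ x * |fderiv ℝ u x (Pi.single i 1)| ^ α x)
    (g := fun x => |u x| ^ γ x * |fderiv ℝ u x (Pi.single i 1)| ^ β x) (by
      filter_upwards [hα1, hβ1, hβα, hξβγα] with x h1 h2 h3 h4
      exact rpow_mul_rpow_le_add_one (abs_nonneg _) (abs_nonneg _) (by linarith)
        (by linarith) h3 h4)
  rw [Measure.restrict_apply_univ] at h₀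
  simp only [Measure.restrict_apply_univ] at h₁
  have h₂ := Finset.sum_le_sum fun i (_ : i ∈ Finset.univ) => h₁ i
  rw [Finset.sum_add_distrib, Finset.sum_const, Finset.card_univ, Fintype.card_fin,
    nsmul_eq_mul] at h₂
  unfold ReFun
  refine (add_le_add h₀ h₂).trans (le_of_eq ?_)
  ring
end

section
/- Let Ω ⊂ ℝⁿ (n ≥ 2) be a bounded domain with Lipschitz boundary, let γ, β, θ ∈ M₀(Ω) with θ(x) ≥ γ(x) + β(x) + ε₀ a.e. for some ε₀ > 0, and let p ∈ M₀(Ω) with p(x) ≥ θ(x) a.e. Then for every u ∈ C¹(Ω), if ∫_Ω |u|^{p(x)} dx < ∞ and ∫_Ω |D_i u|^{p(x)} dx < ∞ for each i ∈ {1,…,n}, then Re^{γ,β,θ}(u) := ∫_Ω |u|^{θ(x)} dx + ∑_{i=1}^n ∫_Ω |u|^{γ(x)} |D_i u|^{β(x)} dx < ∞; that is, the embedding W^{1,p(x)}(Ω) ⊂ S_{1,γ(x),β(x),θ(x)}(Ω) holds. -/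
open MeasureTheory Real Set
open scoped ENNReal

/-- A power with nonnegative exponent `s ≤ q` is dominated by `1 + a ^ q`. -/
theorem rpow_le_one_add_rpow {a s q : ℝ} (ha : 0 ≤ a) (hs : 0 ≤ s) (hsq : s ≤ q) :
    a ^ s ≤ 1 + a ^ q := by
  rcases le_total a 1 with h | h
  · linarith [Real.rpow_le_one ha h hs, Real.rpow_nonneg ha q]
  · linarith [Real.rpow_le_rpow_of_exponent_le h hsq]

/-- A product of powers with `s + t ≤ q` is dominated by `1 + (a ^ q + b ^ q)`. -/
theorem rpow_mul_rpow_le_one_add {a b s t q : ℝ} (ha : 0 ≤ a) (hb : 0 ≤ b)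
    (hs : 0 ≤ s) (ht : 0 ≤ t) (hq : s + t ≤ q) :
    a ^ s * b ^ t ≤ 1 + (a ^ q + b ^ q) := by
  wlog hab : a ≤ b generalizing a b s t
  · have h := this hb ha ht hs (by linarith) (le_of_not_ge hab)
    linarith [mul_comm (a ^ s) (b ^ t)]
  calc a ^ s * b ^ t ≤ b ^ s * b ^ t := by gcongr
    _ = b ^ (s + t) := (Real.rpow_add_of_nonneg hb hs ht).symm
    _ ≤ 1 + b ^ q := rpow_le_one_add_rpow hb (by linarith) hq
    _ ≤ 1 + (a ^ q + b ^ q) := by linarith [Real.rpow_nonneg ha q]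

/-- Theorem 2.3: Let `Ω ⊂ ℝⁿ` (`n ≥ 2`) be a bounded domain with
(Lipschitz) boundary, `γ, β, θ ∈ M₀(Ω)` with `θ(x) ≥ γ(x) + β(x) + ε₀` a.e. for some
`ε₀ > 0`, and `p ∈ M₀(Ω)` with `p(x) ≥ θ(x)` a.e.  Then for every `u ∈ C¹(Ω)`:
if `∫_Ω |u|^{p(x)} dx < ∞` and `∫_Ω |D_i u|^{p(x)} dx < ∞` for each `i`, then
`Re^{γ,β,θ}(u) < ∞`; that is, `W^{1,p(x)}(Ω) ⊂ S_{1,γ(x),β(x),θ(x)}(Ω)`. -/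
theorem stmt_18 (n : ℕ) (hn : 2 ≤ n) (Ω : Set (Fin n → ℝ))
    (hΩ_open : IsOpen Ω) (hΩ_bdd : Bornology.IsBounded Ω) (hΩ_conn : IsConnected Ω)
    (γ β θ p : (Fin n → ℝ) → ℝ)
    (hγm : Measurable γ) (hβm : Measurable β) (hθm : Measurable θ) (hpm : Measurable p)
    (hγ1 : ∀ᵐ x ∂(volume.restrict Ω), 1 ≤ γ x)
    (hβ1 : ∀ᵐ x ∂(volume.restrict Ω), 1 ≤ β x)
    (hθ1 : ∀ᵐ x ∂(volume.restrict Ω), 1 ≤ θ x)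
    (hp1 : ∀ᵐ x ∂(volume.restrict Ω), 1 ≤ p x)
    (hγb : ∃ M : ℝ, ∀ᵐ x ∂(volume.restrict Ω), γ x ≤ M)
    (hβb : ∃ M : ℝ, ∀ᵐ x ∂(volume.restrict Ω), β x ≤ M)
    (hθb : ∃ M : ℝ, ∀ᵐ x ∂(volume.restrict Ω), θ x ≤ M)
    (hpb : ∃ M : ℝ, ∀ᵐ x ∂(volume.restrict Ω), p x ≤ M)
    (hε₀ : ∃ ε₀ : ℝ, 0 < ε₀ ∧ ∀ᵐ x ∂(volume.restrict Ω), γ x + β x + ε₀ ≤ θ x)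
    (hpθ : ∀ᵐ x ∂(volume.restrict Ω), θ x ≤ p x)
    (u : (Fin n → ℝ) → ℝ) (hu : ContDiffOn ℝ 1 u Ω)
    (hup : (∫⁻ x in Ω, ENNReal.ofReal (|u x| ^ p x)) < ⊤)
    (hDup : ∀ i : Fin n,
      (∫⁻ x in Ω, ENNReal.ofReal (|fderiv ℝ u x (Pi.single i 1)| ^ p x)) < ⊤) :
    ReFun n Ω γ β θ u < ⊤ := by
  obtain ⟨ε₀, hε, hγβ⟩ := hε₀
  have hΩ_fin : (∫⁻ _ in Ω, (1 : ℝ≥0∞)) < ⊤ := by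
    simpa using hΩ_bdd.measure_lt_top
  have hu_meas : AEMeasurable (fun x => ENNReal.ofReal (|u x| ^ p x)) (volume.restrict Ω) := by
    have h : AEMeasurable u (volume.restrict Ω) :=
      hu.continuousOn.aemeasurable hΩ_open.measurableSet
    have habs : AEMeasurable (fun x => |u x|) (volume.restrict Ω) :=
      continuous_abs.measurable.comp_aemeasurable h
    exact (habs.pow hpm.aemeasurable).ennreal_ofReal
  refine ENNReal.add_lt_top.2 ⟨?_, ENNReal.sum_lt_top.2 fun i _ => ?_⟩
  · calc (∫⁻ x in Ω, ENNReal.ofReal (|u x| ^ θ x))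
        ≤ ∫⁻ x in Ω, (1 + ENNReal.ofReal (|u x| ^ p x)) := by
          refine lintegral_mono_ae ?_
          filter_upwards [hθ1, hpθ] with x hx hxp
          rw [← ENNReal.ofReal_one, ← ENNReal.ofReal_add zero_le_one (by positivity)]
          exact ENNReal.ofReal_le_ofReal
            (rpow_le_one_add_rpow (abs_nonneg _) (by linarith) hxp)
      _ = (∫⁻ _ in Ω, (1 : ℝ≥0∞)) + ∫⁻ x in Ω, ENNReal.ofReal (|u x| ^ p x) :=
          lintegral_add_left measurable_const _
      _ < ⊤ := ENNReal.add_lt_top.2 ⟨hΩ_fin, hup⟩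
  · calc (∫⁻ x in Ω, ENNReal.ofReal (|u x| ^ γ x * |fderiv ℝ u x (Pi.single i 1)| ^ β x))
        ≤ ∫⁻ x in Ω, (1 + (ENNReal.ofReal (|u x| ^ p x) +
            ENNReal.ofReal (|fderiv ℝ u x (Pi.single i 1)| ^ p x))) := by
          refine lintegral_mono_ae ?_
          filter_upwards [hγ1, hβ1, hγβ, hpθ] with x hxγ hxβ hxs hxp
          rw [← ENNReal.ofReal_one, ← ENNReal.ofReal_add (by positivity) (by positivity),
            ← ENNReal.ofReal_add zero_le_one (by positivity)]
          exact ENNReal.ofReal_le_ofReal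
            (rpow_mul_rpow_le_one_add (abs_nonneg _) (abs_nonneg _) (by linarith)
              (by linarith) (by linarith))
      _ = (∫⁻ _ in Ω, (1 : ℝ≥0∞)) + ((∫⁻ x in Ω, ENNReal.ofReal (|u x| ^ p x)) +
            ∫⁻ x in Ω, ENNReal.ofReal (|fderiv ℝ u x (Pi.single i 1)| ^ p x)) := by
          rw [lintegral_add_left measurable_const, lintegral_add_left' hu_meas]
      _ < ⊤ := ENNReal.add_lt_top.2 ⟨hΩ_fin, ENNReal.add_lt_top.2 ⟨hup, hDup i⟩⟩
end

section
/- Let Ω ⊂ ℝⁿ (n ≥ 2) be a bounded domain with Lipschitz boundary and γ, β, θ ∈ M₀(Ω) with θ(x) ≥ γ(x) + β(x) + ε₀ a.e. for some ε₀ > 0. For u ∈ C¹(Ω) with Re^{γ,β,θ}(u) < ∞ define λ_u := inf{ λ > 0 : ∫_Ω |u/λ|^{θ(x)} dx + ∑_{i=1}^n ∫_Ω ( |u|^{γ(x)/β(x)} |D_i u| / λ^{γ(x)/β(x)+1} )^{β(x)} dx ≤ 1 }. Then min{ λ_u^{γ⁻+β⁻}, λ_u^{θ⁺} } ≤ Re^{γ,β,θ}(u)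 ≤ max{ λ_u^{γ⁻+β⁻}, λ_u^{θ⁺} }, where γ⁻ = ess inf γ, β⁻ = ess inf β and θ⁺ = ess sup θ. -/
open MeasureTheory Real Set

/-- The real-valued functional
`Re^{γ,β,θ}(u) = ∫_Ω |u|^{θ(x)} dx + ∑_i ∫_Ω |u|^{γ(x)} |D_i u|^{β(x)} dx`. -/
noncomputable def ReR (n : ℕ) (Ω : Set (Fin n → ℝ))
    (γ β θ : (Fin n → ℝ) → ℝ) (u : (Fin n → ℝ) → ℝ) : ℝ :=
  (∫ x in Ω, |u x| ^ θ x) +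
    ∑ i : Fin n, ∫ x in Ω, |u x| ^ γ x * |fderiv ℝ u x (Pi.single i 1)| ^ β x

/-- The Luxemburg-type pseudo-norm `λ_u = [u]_{S_{γ,β,θ}}` of the variable-exponent
pn-space `S_{1,γ(x),β(x),θ(x)}(Ω)`. -/
noncomputable def luxPN (n : ℕ) (Ω : Set (Fin n → ℝ))
    (γ β θ : (Fin n → ℝ) → ℝ) (u : (Fin n → ℝ) → ℝ) : ℝ :=
  sInf {l : ℝ | 0 < l ∧
    (∫ x in Ω, |u x / l| ^ θ x) +
      ∑ i : Fin n, ∫ x in Ω,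
        (|u x| ^ (γ x / β x) * |fderiv ℝ u x (Pi.single i 1)| / l ^ (γ x / β x + 1))
          ^ β x ≤ 1}

theorem min_rpow_le_rpow {l a b p : ℝ} (hl : 0 < l) (ha : a ≤ p) (hb : p ≤ b) :
    min (l ^ a) (l ^ b) ≤ l ^ p := by
  rcases le_total 1 l with h | h
  · exact (min_le_left _ _).trans (Real.rpow_le_rpow_of_exponent_le h ha)
  · exact (min_le_right _ _).trans (Real.rpow_le_rpow_of_exponent_ge hl h hb)

theorem rpow_le_max_rpow {l a b p : ℝ} (hl : 0 < l) (ha : a ≤ p) (hb : p ≤ b) :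
    l ^ p ≤ max (l ^ a) (l ^ b) := by
  rcases le_total 1 l with h | h
  · exact (Real.rpow_le_rpow_of_exponent_le h hb).trans (le_max_right _ _)
  · exact (Real.rpow_le_rpow_of_exponent_ge hl h ha).trans (le_max_left _ _)

/-- Dividing a nonnegative integrable function by `l ^ p`, with `p` a variable exponent between
`a` and `b`, divides its integral by a factor between `min (l ^ a) (l ^ b)` and
`max (l ^ a) (l ^ b)`. -/
theorem integral_div_rpow_bounds {α : Type*} [MeasurableSpace α] {μ : Measure α} {f p : α → ℝ}
    {a b l : ℝ} (hl : 0 < l) (hf : Integrable f μ) (hf0 : ∀ x, 0 ≤ f x) (hp : Measurable p)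
    (ha : ∀ᵐ x ∂μ, a ≤ p x) (hb : ∀ᵐ x ∂μ, p x ≤ b) :
    min (l ^ a) (l ^ b) * ∫ x, f x / l ^ p x ∂μ ≤ ∫ x, f x ∂μ ∧
      ∫ x, f x ∂μ ≤ max (l ^ a) (l ^ b) * ∫ x, f x / l ^ p x ∂μ := by
  have hmin : 0 < min (l ^ a) (l ^ b) :=
    lt_min (Real.rpow_pos_of_pos hl _) (Real.rpow_pos_of_pos hl _)
  have hint : Integrable (fun x => f x / l ^ p x) μ := by
    refine (hf.div_const (min (l ^ a) (l ^ b))).mono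
      (hf.aestronglyMeasurable.div₀ (hp.const_pow l).aestronglyMeasurable) ?_
    filter_upwards [ha, hb] with x hxa hxb
    rw [Real.norm_of_nonneg (div_nonneg (hf0 x) (Real.rpow_nonneg hl.le _)),
      Real.norm_of_nonneg (div_nonneg (hf0 x) hmin.le)]
    exact div_le_div_of_nonneg_left (hf0 x) hmin (min_rpow_le_rpow hl hxa hxb)
  rw [← integral_const_mul, ← integral_const_mul]
  constructor
  · refine integral_mono_ae (hint.const_mul _) hf ?_
    filter_upwards [ha, hb] with x hxa hxb
    have hlp := Real.rpow_pos_of_pos hl (p x)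
    calc min (l ^ a) (l ^ b) * (f x / l ^ p x)
        ≤ l ^ p x * (f x / l ^ p x) :=
          mul_le_mul_of_nonneg_right (min_rpow_le_rpow hl hxa hxb) (div_nonneg (hf0 x) hlp.le)
      _ = f x := by field_simp
  · refine integral_mono_ae hf (hint.const_mul _) ?_
    filter_upwards [ha, hb] with x hxa hxb
    have hlp := Real.rpow_pos_of_pos hl (p x)
    calc f x = l ^ p x * (f x / l ^ p x) := by field_simp
      _ ≤ max (l ^ a) (l ^ b) * (f x / l ^ p x) :=
          mul_le_mul_of_nonneg_right (rpow_le_max_rpow hl hxa hxb) (div_nonneg (hf0 x) hlp.le)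

/-- If a modular `F` satisfies `min (l ^ a) (l ^ b) * F l ≤ R ≤ max (l ^ a) (l ^ b) * F l` for all
`l > 0`, then its Luxemburg gauge `inf {l > 0 | F l ≤ 1}` satisfies the same bounds with `F l`
replaced by `1`. -/
theorem luxemburg_gauge_bounds {F : ℝ → ℝ} {R a b : ℝ} (ha : 0 < a) (hb : 0 < b) (hR : 0 ≤ R)
    (hlow : ∀ l, 0 < l → min (l ^ a) (l ^ b) * F l ≤ R)
    (hupp : ∀ l, 0 < l → R ≤ max (l ^ a) (l ^ b) * F l) :
    min (sInf {l | 0 < l ∧ F l ≤ 1} ^ a) (sInf {l | 0 < l ∧ F l ≤ 1} ^ b) ≤ R ∧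
      R ≤ max (sInf {l | 0 < l ∧ F l ≤ 1} ^ a) (sInf {l | 0 < l ∧ F l ≤ 1} ^ b) := by
  set S := {l | 0 < l ∧ F l ≤ 1} with hS
  have hmem : ∀ l, 0 < l → R < min (l ^ a) (l ^ b) → l ∈ S := fun l hl h =>
    ⟨hl, by by_contra! hF; nlinarith [hlow l hl]⟩
  have hbdd : BddBelow S := ⟨0, fun l hl => hl.1.le⟩
  have hca : Continuous fun l : ℝ => l ^ a := Real.continuous_rpow_const ha.le
  have hcb : Continuous fun l : ℝ => l ^ b := Real.continuous_rpow_const hb.le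
  have hne : S.Nonempty := by
    obtain ⟨l, hla, hlb, hl⟩ := (((tendsto_rpow_atTop ha).eventually_gt_atTop R).and
      (((tendsto_rpow_atTop hb).eventually_gt_atTop R).and
        (Filter.eventually_gt_atTop 0))).exists
    exact ⟨l, hmem l hl (lt_min hla hlb)⟩
  constructor
  · by_contra! h
    have h0 : 0 < sInf S := by
      refine (Real.sInf_nonneg fun l hl => hl.1.le).lt_of_ne fun h0 => ?_
      rw [← h0, Real.zero_rpow ha.ne', Real.zero_rpow hb.ne', min_self] at h
      exact h.not_ge hR
    have hev := ((hca.min hcb).continuousAt.eventually (lt_mem_nhds h)).and (lt_mem_nhds h0)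
    obtain ⟨l, ⟨hl, hl0⟩, hlt⟩ :=
      ((hev.filter_mono nhdsWithin_le_nhds).and (self_mem_nhdsWithin (s := Iio (sInf S)))).exists
    exact (csInf_le hbdd (hmem l hl0 hl)).not_gt hlt
  · have hcl : IsClosed {l : ℝ | R ≤ max (l ^ a) (l ^ b)} :=
      isClosed_le continuous_const (hca.max hcb)
    refine closure_minimal (fun l hl => ?_) hcl (csInf_mem_closure hne hbdd)
    exact (hupp l hl.1).trans (mul_le_of_le_one_right
      (le_max_of_le_left (Real.rpow_nonneg hl.1.le _)) hl.2)

/-- Lemma 2.7: Let `Ω ⊂ ℝⁿ` (`n ≥ 2`) be a bounded domain with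
(Lipschitz) boundary and `γ, β, θ ∈ M₀(Ω)` with `θ(x) ≥ γ(x) + β(x) + ε₀` a.e. for
some `ε₀ > 0`.  For `u ∈ C¹(Ω)` with `Re^{γ,β,θ}(u) < ∞` and `λ_u` its
Luxemburg-type pseudo-norm,
`min{λ_u^{γ⁻+β⁻}, λ_u^{θ⁺}} ≤ Re^{γ,β,θ}(u) ≤ max{λ_u^{γ⁻+β⁻}, λ_u^{θ⁺}}`. -/
theorem stmt_19 (n : ℕ) (hn : 2 ≤ n) (Ω : Set (Fin n → ℝ))
    (hΩ_open : IsOpen Ω) (hΩ_bdd : Bornology.IsBounded Ω) (hΩ_conn : IsConnected Ω)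
    (γ β θ : (Fin n → ℝ) → ℝ)
    (hγm : Measurable γ) (hβm : Measurable β) (hθm : Measurable θ)
    (hγ1 : ∀ᵐ x ∂(volume.restrict Ω), 1 ≤ γ x)
    (hβ1 : ∀ᵐ x ∂(volume.restrict Ω), 1 ≤ β x)
    (hθ1 : ∀ᵐ x ∂(volume.restrict Ω), 1 ≤ θ x)
    (hγb : ∃ M : ℝ, ∀ᵐ x ∂(volume.restrict Ω), γ x ≤ M)
    (hβb : ∃ M : ℝ, ∀ᵐ x ∂(volume.restrict Ω), β x ≤ M)
    (hθb : ∃ M : ℝ, ∀ᵐ x ∂(volume.restrict Ω), θ x ≤ M)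
    (hε₀ : ∃ ε₀ : ℝ, 0 < ε₀ ∧ ∀ᵐ x ∂(volume.restrict Ω), γ x + β x + ε₀ ≤ θ x)
    (u : (Fin n → ℝ) → ℝ) (hu : ContDiffOn ℝ 1 u Ω)
    (hfin₀ : IntegrableOn (fun x => |u x| ^ θ x) Ω)
    (hfin₁ : ∀ i : Fin n,
      IntegrableOn (fun x => |u x| ^ γ x * |fderiv ℝ u x (Pi.single i 1)| ^ β x) Ω) :
    min ((luxPN n Ω γ β θ u) ^
          (essInf γ (volume.restrict Ω) + essInf β (volume.restrict Ω)))
        ((luxPN n Ω γ β θ u) ^ essSup θ (volume.restrict Ω)) ≤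
      ReR n Ω γ β θ u ∧
    ReR n Ω γ β θ u ≤
      max ((luxPN n Ω γ β θ u) ^
            (essInf γ (volume.restrict Ω) + essInf β (volume.restrict Ω)))
          ((luxPN n Ω γ β θ u) ^ essSup θ (volume.restrict Ω)) := by
  set μ := (volume : Measure (Fin n → ℝ)).restrict Ω with hμ
  have : NeZero μ := ⟨by
    rw [hμ, Ne, Measure.restrict_eq_zero]
    exact (hΩ_open.measure_pos volume hΩ_conn.nonempty).ne'⟩
  have hle : ∀ p : (Fin n → ℝ) → ℝ, (∀ᵐ x ∂μ, 1 ≤ p x) → (∃ M : ℝ, ∀ᵐ x ∂μ, p x ≤ M) →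
      1 ≤ essInf p μ ∧ (∀ᵐ x ∂μ, essInf p μ ≤ p x) ∧ ∀ᵐ x ∂μ, p x ≤ essSup p μ := by
    rintro p h1 ⟨M, hM⟩
    have hbelow : Filter.IsBoundedUnder (· ≥ ·) (ae μ) p := ⟨1, by simpa using h1⟩
    have habove : Filter.IsBoundedUnder (· ≤ ·) (ae μ) p := ⟨M, by simpa using hM⟩
    exact ⟨Filter.le_liminf_of_le habove.isCoboundedUnder_ge h1, ae_essInf_le hbelow,
      ae_le_essSup habove⟩
  obtain ⟨hγ1', hγ_inf, -⟩ := hle γ hγ1 hγb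
  obtain ⟨hβ1', hβ_inf, -⟩ := hle β hβ1 hβb
  obtain ⟨-, -, hθ_sup⟩ := hle θ hθ1 hθb
  obtain ⟨ε, hε, hγβθ⟩ := hε₀
  set a := essInf γ μ + essInf β μ
  set b := essSup θ μ
  have hγβ_low : ∀ᵐ x ∂μ, a ≤ γ x + β x := by
    filter_upwards [hγ_inf, hβ_inf] with x h1 h2 using add_le_add h1 h2
  have hγβ_upp : ∀ᵐ x ∂μ, γ x + β x ≤ b := by
    filter_upwards [hγβθ, hθ_sup] with x h1 h2 using by linarith
  have hθ_low : ∀ᵐ x ∂μ, a ≤ θ x := by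
    filter_upwards [hγβθ, hγβ_low] with x h1 h2 using by linarith
  have ha : 0 < a := by linarith
  have hb : 0 < b := by
    obtain ⟨x, h1, h2⟩ := (hθ_low.and hθ_sup).exists
    linarith
  have hg0 : ∀ i x, 0 ≤ |u x| ^ γ x * |fderiv ℝ u x (Pi.single i 1)| ^ β x := fun i x => by
    positivity
  have hscale₀ : ∀ l : ℝ, 0 < l →
      ∫ x in Ω, |u x / l| ^ θ x = ∫ x in Ω, |u x| ^ θ x / l ^ θ x := fun l hl => by
    congr 1 with x
    rw [abs_div, abs_of_pos hl, Real.div_rpow (abs_nonneg _) hl.le]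
  have hscale₁ : ∀ (i : Fin n) (l : ℝ), 0 < l →
      ∫ x in Ω, (|u x| ^ (γ x / β x) * |fderiv ℝ u x (Pi.single i 1)| /
          l ^ (γ x / β x + 1)) ^ β x =
        ∫ x in Ω, (|u x| ^ γ x * |fderiv ℝ u x (Pi.single i 1)| ^ β x) /
          l ^ (γ x + β x) := fun i l hl => by
    refine integral_congr_ae ?_
    filter_upwards [hβ1] with x hx
    have hβ0 : β x ≠ 0 := by linarith
    rw [Real.div_rpow (by positivity) (by positivity),
      Real.mul_rpow (by positivity) (abs_nonneg _), ← Real.rpow_mul (abs_nonneg _),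
      ← Real.rpow_mul hl.le, add_mul, one_mul, div_mul_cancel₀ _ hβ0]
  refine luxemburg_gauge_bounds ha hb ?_ (fun l hl => ?_) (fun l hl => ?_)
  · exact add_nonneg (integral_nonneg fun x => by positivity)
      (Finset.sum_nonneg fun i _ => integral_nonneg (hg0 i))
  · rw [hscale₀ l hl, Finset.sum_congr rfl fun i _ => hscale₁ i l hl, mul_add, Finset.mul_sum]
    exact add_le_add
      (integral_div_rpow_bounds hl hfin₀ (fun x => by positivity) hθm hθ_low hθ_sup).1
      (Finset.sum_le_sum fun i _ =>
        (integral_div_rpow_bounds hl (hfin₁ i) (hg0 i) (hγm.add hβm) hγβ_low hγβ_upp).1)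
  · rw [hscale₀ l hl, Finset.sum_congr rfl fun i _ => hscale₁ i l hl, mul_add, Finset.mul_sum]
    exact add_le_add
      (integral_div_rpow_bounds hl hfin₀ (fun x => by positivity) hθm hθ_low hθ_sup).2
      (Finset.sum_le_sum fun i _ =>
        (integral_div_rpow_bounds hl (hfin₁ i) (hg0 i) (hγm.add hβm) hγβ_low hγβ_upp).2)
end
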